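/- arXiv:2511.12315 — 2 statements merged into one kernel-verified Lean document; each statement's English description precedes it below -/
import Mathlib

section
/- Let r ∈ ℚ and let q ≠ 0 be a strict convergent fraction of r. Then the unordered interval ⟦q, parent(q)⟧ fully contains the interval [left(r), right(r)]. -/
/-- Fractions are pairs `(numerator, denominator)` of integers; `(-1,0)` is `-∞`, `(1,0)` is `∞`. -/
def mediant (p q : ℤ × ℤ) : ℤ × ℤ := (p.1 + q.1, p.2 + q.2)

/-- The Stern–Brocot boundary relation `B`: `SBB l m r` means `(l, m, r) ∈ B`. -/
inductive SBB : ℤ × ℤ → ℤ × ℤ → ℤ × ℤ → Prop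
  | base : SBB (-1, 0) (0, 1) (1, 0)
  | left {l m r : ℤ × ℤ} : SBB l m r → SBB l (mediant l m) m
  | right {l m r : ℤ × ℤ} : SBB l m r → SBB m (mediant m r) r

/-- One step down the Stern–Brocot tree; the state is the triple
(left bound, node, right bound); `false` is an L-move, `true` an R-move. -/
def sbStep : (ℤ × ℤ) × (ℤ × ℤ) × (ℤ × ℤ) → Bool → (ℤ × ℤ) × (ℤ × ℤ) × (ℤ × ℤ)
  | (l, m, _r), false => (l, mediant l m, m)
  | (_l, m, r), true => (m, mediant m r, r)

/-- Boundary triple of the node reached from the root `0/1` by the path `s ∈ {L,R}*`. -/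
def sbTriple (s : List Bool) : (ℤ × ℤ) × (ℤ × ℤ) × (ℤ × ℤ) :=
  s.foldl sbStep ((-1, 0), (0, 1), (1, 0))

/-- The (numerator, denominator) of the node reached by the path `s`. -/
def sbNode (s : List Bool) : ℤ × ℤ := (sbTriple s).2.1

/-- The rational number at the node of the Stern–Brocot tree reached by the path `s`. -/
def sbVal (s : List Bool) : ℚ := ((sbNode s).1 : ℚ) / ((sbNode s).2 : ℚ)

/-- The path (string in {L,R}*) whose run-length encoding is the block list `l`,
the first block being in direction `b` (`true` = R, `false` = L). -/
def pathOf (b : Bool) : List ℕ → List Bool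
  | [] => []
  | a :: rest => List.replicate a b ++ pathOf (!b) rest

/-- `s` is the path of a convergent fraction of the node with path `t`:
either `s = t`, or `s` corresponds to the first `m` blocks (1 ≤ m ≤ n) of the
run-length (SB-)encoding of `t`. -/
def ConvPath (s t : List Bool) : Prop :=
  s = t ∨ ∃ (b : Bool) (l : List ℕ) (m : ℕ),
    (∀ a ∈ l, 0 < a) ∧ 0 < m ∧ m ≤ l.length ∧ t = pathOf b l ∧ s = pathOf b (l.take m)

/-- `s` is the path of a strict convergent fraction of the node with path `t`. -/
def StrictConvPath (s t : List Bool) : Prop :=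
  ∃ (b : Bool) (l : List ℕ) (m : ℕ),
    (∀ a ∈ l, 0 < a) ∧ 0 < m ∧ m < l.length ∧ t = pathOf b l ∧ s = pathOf b (l.take m)

/-- `p` is a convergent fraction of `r` in the Stern–Brocot tree. -/
def ConvOf (p r : ℚ) : Prop := ∃ s t : List Bool, sbVal s = p ∧ sbVal t = r ∧ ConvPath s t

/-- `r` is a (strict) ancestor of `p` in the Stern–Brocot tree, i.e. `p` is a descendant of `r`. -/
def IsAncestor (r p : ℚ) : Prop := ∃ s t : List Bool, sbVal s = r ∧ t ≠ [] ∧ sbVal (s ++ t) = p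

/-- `(p, q)` is an edge of the Stern–Brocot tree, `q` a child of `p`. -/
def IsEdge (p q : ℚ) : Prop := ∃ (s : List Bool) (d : Bool), sbVal s = p ∧ sbVal (s ++ [d]) = q

/-- An interval of `ℚ`: a nonempty order-convex set. -/
def IsInterval (I : Set ℚ) : Prop :=
  I.Nonempty ∧ ∀ p ∈ I, ∀ q ∈ I, ∀ r : ℚ, p < r → r < q → r ∈ I

/-- An interval partition of `ℚ`: a list of intervals, pointwise increasing, covering `ℚ`. -/
def IsIntervalPartition (P : List (Set ℚ)) : Prop :=
  (∀ I ∈ P, IsInterval I) ∧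
  P.Pairwise (fun I J => ∀ p ∈ I, ∀ q ∈ J, p < q) ∧
  (∀ x : ℚ, ∃ I ∈ P, x ∈ I)

/-- `I` is monochromatic with respect to `γ`: `γ` is constant on `I`. -/
def Monochromatic {S : Type*} (γ : ℚ → S) (I : Set ℚ) : Prop :=
  ∀ p ∈ I, ∀ q ∈ I, γ p = γ q

/-- `γ` is a finite piecewise function. -/
def FinitePW {S : Type*} (γ : ℚ → S) : Prop :=
  ∃ P : List (Set ℚ), IsIntervalPartition P ∧ ∀ I ∈ P, Monochromatic γ I

/-- `P` is the canonical representation of `γ`: an interval partition into monochromatic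
pieces on which `γ` takes different constant values on adjacent pieces. -/
def IsCanonicalRep {S : Type*} (γ : ℚ → S) (P : List (Set ℚ)) : Prop :=
  IsIntervalPartition P ∧ (∀ I ∈ P, Monochromatic γ I) ∧
  P.Chain' (fun I J => ∀ p ∈ I, ∀ q ∈ J, γ p ≠ γ q)

/-- `x ∈ bounds(γ)`: `x` is a (rational) infimum or supremum of an interval of the
canonical representation of `γ`. -/
def IsBound {S : Type*} (γ : ℚ → S) (x : ℚ) : Prop :=
  ∃ P, IsCanonicalRep γ P ∧ ∃ I ∈ P, IsGLB I x ∨ IsLUB I x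

/-- `x` is a left-bound of `γ`: the minimum of some interval of the canonical representation. -/
def IsLeftBound {S : Type*} (γ : ℚ → S) (x : ℚ) : Prop :=
  ∃ P, IsCanonicalRep γ P ∧ ∃ I ∈ P, IsLeast I x

/-- `x` is a right-bound of `γ`: the maximum of some interval of the canonical representation. -/
def IsRightBound {S : Type*} (γ : ℚ → S) (x : ℚ) : Prop :=
  ∃ P, IsCanonicalRep γ P ∧ ∃ I ∈ P, IsGreatest I x

/-- `(p, q)` is a break link of `γ`: an edge of the Stern–Brocot tree such that `p = 0/1`
or the unordered closed interval `⟦p, q⟧` is not monochromatic w.r.t. `γ`. -/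
def IsBreakLink {S : Type*} (γ : ℚ → S) (p q : ℚ) : Prop :=
  IsEdge p q ∧ (p = 0 ∨ ¬ Monochromatic γ (Set.uIcc p q))

/-- `cfval [a₁,…,aₙ] = a₁ + 1/(a₂ + 1/(⋯ + 1/(aₙ + 1)))`. -/
def cfval : List ℕ → ℚ
  | [] => 1
  | [a] => (a : ℚ) + 1
  | a :: b :: rest => (a : ℚ) + 1 / cfval (b :: rest)

/-- After a proper nonempty initial list of blocks, the path turns. -/
theorem pathOf_take_turn (l : List ℕ) : ∀ (b : Bool) (m : ℕ), (∀ a ∈ l, 0 < a) → 0 < m →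
    m < l.length → ∃ (p : List Bool) (d : Bool) (u : List Bool),
      pathOf b (l.take m) = p ++ [d] ∧ pathOf b l = p ++ d :: (!d) :: u := by
  induction l with
  | nil => intro b m _ _ h; simp at h
  | cons a rest ih =>
    intro b m hpos hm hml
    obtain ⟨k, rfl⟩ := Nat.exists_eq_add_of_lt hm
    rw [zero_add] at hml ⊢
    by_cases hk : k = 0
    · subst hk
      cases rest with
      | nil => simp at hml
      | cons a' rest' =>
        obtain ⟨i, rfl⟩ := Nat.exists_eq_succ_of_ne_zero (hpos a (by simp)).ne'
        obtain ⟨j, rfl⟩ := Nat.exists_eq_succ_of_ne_zero (hpos a' (by simp)).ne'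
        refine ⟨List.replicate i b, b, List.replicate j (!b) ++ pathOf (!(!b)) rest', ?_, ?_⟩
        · simp [pathOf, List.replicate_succ']
        · simp only [pathOf, Nat.succ_eq_add_one]
          rw [List.replicate_succ' (n := i), List.replicate_succ (n := j)]
          simp
    · obtain ⟨p, d, u, h₁, h₂⟩ := ih (!b) k (fun x hx => hpos x (by simp [hx]))
        (Nat.pos_of_ne_zero hk) (by simpa using hml)
      refine ⟨List.replicate a b ++ p, d, u, ?_, ?_⟩
      · simp [pathOf, h₁]
      · simp [pathOf, h₂]

/-- The fraction `x` has positive denominator and its value lies in `[lo, hi]`. -/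
def FracIn (lo hi : ℚ) (x : ℤ × ℤ) : Prop :=
  0 < x.2 ∧ lo * x.2 ≤ x.1 ∧ (x.1 : ℚ) ≤ hi * x.2

theorem fracIn_iff {lo hi : ℚ} {x : ℤ × ℤ} (hx : 0 < x.2) :
    FracIn lo hi x ↔ (x.1 : ℚ) / x.2 ∈ Set.Icc lo hi := by
  have h : (0 : ℚ) < x.2 := by exact_mod_cast hx
  simp [FracIn, hx, le_div_iff₀ h, div_le_iff₀ h]

theorem FracIn.mediant {lo hi : ℚ} {x y : ℤ × ℤ} (hx : FracIn lo hi x) (hy : FracIn lo hi y) :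
    FracIn lo hi (mediant x y) := by
  obtain ⟨h₁, h₂, h₃⟩ := hx
  obtain ⟨k₁, k₂, k₃⟩ := hy
  refine ⟨add_pos h₁ k₁, ?_, ?_⟩ <;> simp only [_root_.mediant] <;> push_cast <;> linarith

/-- All three fractions of a boundary triple lie in `[lo, hi]`. -/
def TripleIn (lo hi : ℚ) (T : (ℤ × ℤ) × (ℤ × ℤ) × (ℤ × ℤ)) : Prop :=
  FracIn lo hi T.1 ∧ FracIn lo hi T.2.1 ∧ FracIn lo hi T.2.2

theorem TripleIn.foldl {lo hi : ℚ} (u : List Bool) :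
    ∀ {T}, TripleIn lo hi T → TripleIn lo hi (u.foldl sbStep T) := by
  induction u with
  | nil => exact fun h => h
  | cons d u ih =>
    rintro ⟨l, m, r⟩ ⟨hl, hm, hr⟩
    apply ih
    cases d
    · exact ⟨hl, hl.mediant hm, hm⟩
    · exact ⟨hm, hm.mediant hr, hr⟩

theorem sbTriple_append (s u : List Bool) : sbTriple (s ++ u) = u.foldl sbStep (sbTriple s) :=
  List.foldl_append

theorem sbTriple_den (s : List Bool) :
    0 ≤ (sbTriple s).1.2 ∧ 0 < (sbTriple s).2.1.2 ∧ 0 ≤ (sbTriple s).2.2.2 := by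
  induction s using List.reverseRecOn with
  | nil => simp [sbTriple]
  | append_singleton s d ih =>
    rw [sbTriple_append]
    obtain ⟨hl, hm, hr⟩ := ih
    cases d <;> simp only [List.foldl_cons, List.foldl_nil, sbStep, mediant] <;>
      refine ⟨?_, ?_, ?_⟩ <;> linarith

theorem fracIn_sbNode_iff {lo hi : ℚ} (s : List Bool) :
    FracIn lo hi (sbNode s) ↔ sbVal s ∈ Set.Icc lo hi :=
  fracIn_iff (sbTriple_den s).2.1

/-- Every node below the turn `d, !d` lies between the two nodes joined by the move `d`. -/
theorem sbVal_mem_uIcc_of_turn (p : List Bool) (d : Bool) (u : List Bool) :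
    sbVal (p ++ d :: (!d) :: u) ∈ Set.uIcc (sbVal (p ++ [d])) (sbVal p) := by
  have hq := (fracIn_sbNode_iff (p ++ [d])).2
    (Set.left_mem_uIcc (a := sbVal (p ++ [d])) (b := sbVal p))
  have hp := (fracIn_sbNode_iff p).2
    (Set.right_mem_uIcc (a := sbVal (p ++ [d])) (b := sbVal p))
  refine (fracIn_sbNode_iff _).1 ?_
  have hT : TripleIn (sbVal (p ++ [d]) ⊓ sbVal p) (sbVal (p ++ [d]) ⊔ sbVal p)
      (sbTriple (p ++ [d, !d])) := by
    simp only [sbNode, sbTriple_append] at hp hq ⊢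
    cases d
    · exact ⟨hq, hq.mediant hp, hp⟩
    · exact ⟨hp, hp.mediant hq, hq⟩
  have h := (hT.foldl u).2.1
  rw [← sbTriple_append] at h
  simpa [sbNode] using h

/-- if `q ≠ 0` is a strict convergent fraction of `r`, then the unordered
interval `⟦q, parent(q)⟧` fully contains the interval `[left(r), right(r)]`.
(`false` = L, `true` = R; `parent(q)` is the node at the path of `q` with its last move
removed.) -/
theorem strict_convergent_interval_containment (s t : List Bool) (q r : ℚ)
    (hq : sbVal s = q) (hr : sbVal t = r) (hq0 : q ≠ 0) (hconv : StrictConvPath s t) :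
    Set.Icc (sbVal (t ++ [false])) (sbVal (t ++ [true])) ⊆
      Set.uIcc q (sbVal s.dropLast) := by
  obtain ⟨b, l, m, hpos, hm, hml, rfl, rfl⟩ := hconv
  obtain ⟨p, d, u, hs, ht⟩ := pathOf_take_turn l b m hpos hm hml
  rw [← hq, hs, ht, List.dropLast_concat]
  have h (e : Bool) := sbVal_mem_uIcc_of_turn p d (u ++ [e])
  exact Set.ordConnected_uIcc.out (by simpa using h false) (by simpa using h true)
end

section
/- (Proposition 3, part 1.) Let γ: ℚ → Σ be a finite piecewise function and let D = (q1,A1),…,(qm,Am) with q1 < q2 < ⋯ < qm, γ(qi) = Ai for all i, and suppose that for every break link (p,q) of γ both p and q belong to {q1,…,qm}. Then for every i, qi is a left-bound of γ if and only if i ≥ 2, q_{i−1} is a descendant of qi in the Stern–Brocot tree, and A_{i−1} ≠ Ai. -/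
/-- The left boundary fraction of the node reached by the path `s`. -/
def sbLeft (s : List Bool) : ℤ × ℤ := (sbTriple s).1

/-- The right boundary fraction of the node reached by the path `s`. -/
def sbRight (s : List Bool) : ℤ × ℤ := (sbTriple s).2.2

theorem sbTriple_snoc (s : List Bool) (d : Bool) :
    sbTriple (s ++ [d]) = sbStep (sbTriple s) d := by
  simp [sbTriple]

@[simp] theorem sbLeft_snoc_false (s : List Bool) : sbLeft (s ++ [false]) = sbLeft s := by
  simp [sbLeft, sbTriple_snoc, sbStep]

@[simp] theorem sbNode_snoc_false (s : List Bool) :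
    sbNode (s ++ [false]) = sbLeft s + sbNode s := by
  simp only [sbNode, sbLeft, sbTriple_snoc, sbStep]; rfl

@[simp] theorem sbRight_snoc_false (s : List Bool) : sbRight (s ++ [false]) = sbNode s := by
  simp [sbRight, sbNode, sbTriple_snoc, sbStep]

@[simp] theorem sbLeft_snoc_true (s : List Bool) : sbLeft (s ++ [true]) = sbNode s := by
  simp [sbLeft, sbNode, sbTriple_snoc, sbStep]

@[simp] theorem sbNode_snoc_true (s : List Bool) :
    sbNode (s ++ [true]) = sbNode s + sbRight s := by
  simp only [sbNode, sbRight, sbTriple_snoc, sbStep]; rfl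

@[simp] theorem sbRight_snoc_true (s : List Bool) : sbRight (s ++ [true]) = sbRight s := by
  simp [sbRight, sbTriple_snoc, sbStep]

/-- The cross product of two fractions, positive iff the first is smaller than the second. -/
def fracCross (u v : ℤ × ℤ) : ℤ := v.1 * u.2 - u.1 * v.2

theorem fracCross_add_right (u v w : ℤ × ℤ) :
    fracCross u (v + w) = fracCross u v + fracCross u w := by
  simp only [fracCross, Prod.fst_add, Prod.snd_add]; ring

theorem fracCross_add_left (u v w : ℤ × ℤ) :
    fracCross (u + v) w = fracCross u w + fracCross v w := by
  simp only [fracCross, Prod.fst_add, Prod.snd_add]; ring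

theorem fracCross_self (u : ℤ × ℤ) : fracCross u u = 0 := by
  simp only [fracCross]; ring

theorem fracCross_swap (u v : ℤ × ℤ) : fracCross u v = -fracCross v u := by
  simp only [fracCross]; ring

theorem sbTriple_invariants (s : List Bool) :
    0 ≤ (sbLeft s).2 ∧ 0 < (sbNode s).2 ∧ 0 ≤ (sbRight s).2 ∧
      fracCross (sbLeft s) (sbNode s) = 1 ∧ fracCross (sbNode s) (sbRight s) = 1 ∧
      0 ≤ fracCross (sbLeft s) (sbRight s) := by
  induction s using List.reverseRecOn with
  | nil => decide
  | append_singleton s d ih =>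
    obtain ⟨hl, hm, hr, hlm, hmr, -⟩ := ih
    cases d <;>
      simp only [sbLeft_snoc_false, sbNode_snoc_false, sbRight_snoc_false, sbLeft_snoc_true,
        sbNode_snoc_true, sbRight_snoc_true, fracCross_add_left, fracCross_add_right,
        fracCross_self, Prod.snd_add, hlm, hmr] <;> omega

theorem sbNode_den_pos (s : List Bool) : 0 < (sbNode s).2 := (sbTriple_invariants s).2.1

theorem fracCross_sbLeft_sbNode (s : List Bool) : fracCross (sbLeft s) (sbNode s) = 1 :=
  (sbTriple_invariants s).2.2.2.1

theorem fracCross_sbNode_sbRight (s : List Bool) : fracCross (sbNode s) (sbRight s) = 1 :=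
  (sbTriple_invariants s).2.2.2.2.1

/-- A rational number as a (numerator, denominator) pair. -/
def ratFrac (p : ℚ) : ℤ × ℤ := (p.num, p.den)

theorem sbVal_sub (s t : List Bool) :
    sbVal t - sbVal s =
      (fracCross (sbNode s) (sbNode t) : ℚ) / ((sbNode s).2 * (sbNode t).2) := by
  have hs : ((sbNode s).2 : ℚ) ≠ 0 := by exact_mod_cast (sbNode_den_pos s).ne'
  have ht : ((sbNode t).2 : ℚ) ≠ 0 := by exact_mod_cast (sbNode_den_pos t).ne'
  simp only [sbVal, fracCross]
  push_cast
  field_simp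

theorem sbVal_lt_iff (s : List Bool) (p : ℚ) :
    sbVal s < p ↔ 0 < fracCross (sbNode s) (ratFrac p) := by
  have hs : (0 : ℚ) < (sbNode s).2 := by exact_mod_cast sbNode_den_pos s
  have hp : (0 : ℚ) < p.den := by exact_mod_cast p.den_pos
  conv_lhs => rw [← Rat.num_div_den p]
  rw [sbVal, div_lt_div_iff₀ hs hp]
  simp only [fracCross, ratFrac, sub_pos]
  exact_mod_cast Iff.rfl

theorem lt_sbVal_iff (s : List Bool) (p : ℚ) :
    p < sbVal s ↔ 0 < fracCross (ratFrac p) (sbNode s) := by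
  have hs : (0 : ℚ) < (sbNode s).2 := by exact_mod_cast sbNode_den_pos s
  have hp : (0 : ℚ) < p.den := by exact_mod_cast p.den_pos
  conv_lhs => rw [← Rat.num_div_den p]
  rw [sbVal, div_lt_div_iff₀ hp hs]
  simp only [fracCross, ratFrac, sub_pos]
  exact_mod_cast Iff.rfl

theorem sbVal_lt_sbVal_iff (s t : List Bool) :
    sbVal s < sbVal t ↔ 0 < fracCross (sbNode s) (sbNode t) := by
  have hs : (0 : ℚ) < (sbNode s).2 := by exact_mod_cast sbNode_den_pos s
  have ht : (0 : ℚ) < (sbNode t).2 := by exact_mod_cast sbNode_den_pos t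
  rw [← sub_pos, sbVal_sub, div_pos_iff_of_pos_right (mul_pos hs ht)]
  exact_mod_cast Iff.rfl

theorem sbVal_snoc_false_lt (s : List Bool) : sbVal (s ++ [false]) < sbVal s := by
  simp [sbVal_lt_sbVal_iff, fracCross_add_left, fracCross_sbLeft_sbNode, fracCross_self]

theorem sbVal_lt_snoc_true (s : List Bool) : sbVal s < sbVal (s ++ [true]) := by
  simp [sbVal_lt_sbVal_iff, fracCross_add_right, fracCross_sbNode_sbRight, fracCross_self]

/-- Every rational strictly between a node and one of its boundary fractions is a descendant. -/
theorem exists_descendant_of_between (n : ℕ) (p : ℚ) (s : List Bool) :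
    (0 < fracCross (sbLeft s) (ratFrac p) → p < sbVal s →
      fracCross (sbLeft s) (ratFrac p) + fracCross (ratFrac p) (sbNode s) ≤ n →
      ∃ t, sbVal (s ++ false :: t) = p) ∧
    (0 < fracCross (ratFrac p) (sbRight s) → sbVal s < p →
      fracCross (sbNode s) (ratFrac p) + fracCross (ratFrac p) (sbRight s) ≤ n →
      ∃ t, sbVal (s ++ true :: t) = p) := by
  induction n generalizing s with
  | zero =>
    refine ⟨fun h₁ h₂ h₃ => ?_, fun h₁ h₂ h₃ => ?_⟩
    · rw [lt_sbVal_iff] at h₂; push_cast at h₃; omega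
    · rw [sbVal_lt_iff] at h₂; push_cast at h₃; omega
  | succ n ih =>
    have descend : ∀ d : Bool,
        0 < fracCross (sbLeft (s ++ [d])) (ratFrac p) →
        0 < fracCross (ratFrac p) (sbRight (s ++ [d])) →
        fracCross (sbLeft (s ++ [d])) (ratFrac p) +
          fracCross (ratFrac p) (sbNode (s ++ [d])) ≤ n →
        fracCross (sbNode (s ++ [d])) (ratFrac p) +
          fracCross (ratFrac p) (sbRight (s ++ [d])) ≤ n →
        ∃ t, sbVal (s ++ d :: t) = p := by
      intro d hl hr hnl hnr
      rcases lt_trichotomy p (sbVal (s ++ [d])) with h | h | h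
      · obtain ⟨t, ht⟩ := (ih (s ++ [d])).1 hl h hnl
        exact ⟨false :: t, by simpa using ht⟩
      · exact ⟨[], h.symm⟩
      · obtain ⟨t, ht⟩ := (ih (s ++ [d])).2 hr h hnr
        exact ⟨true :: t, by simpa using ht⟩
    refine ⟨fun h₁ h₂ h₃ => descend false ?_ ?_ ?_ ?_, fun h₁ h₂ h₃ => descend true ?_ ?_ ?_ ?_⟩
    all_goals
      first | rw [lt_sbVal_iff] at h₂ | rw [sbVal_lt_iff] at h₂
      have e₁ := fracCross_swap (sbLeft s) (ratFrac p)
      have e₂ := fracCross_swap (sbNode s) (ratFrac p)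
      have e₃ := fracCross_swap (sbRight s) (ratFrac p)
      push_cast at h₃
      simp only [sbLeft_snoc_false, sbNode_snoc_false, sbRight_snoc_false, sbLeft_snoc_true,
        sbNode_snoc_true, sbRight_snoc_true, fracCross_add_left, fracCross_add_right]
      omega

theorem exists_sbVal_eq (p : ℚ) : ∃ s, sbVal s = p := by
  rcases lt_trichotomy p (sbVal []) with h | h | h
  · obtain ⟨t, ht⟩ := (exists_descendant_of_between _ p []).1
      (by simpa [fracCross, ratFrac, sbLeft, sbTriple] using p.den_pos) h (Int.self_le_toNat _)
    exact ⟨_, ht⟩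
  · exact ⟨[], h.symm⟩
  · obtain ⟨t, ht⟩ := (exists_descendant_of_between _ p []).2
      (by simpa [fracCross, ratFrac, sbRight, sbTriple] using p.den_pos) h (Int.self_le_toNat _)
    exact ⟨_, ht⟩

theorem fracCross_sbLeft_append (s t : List Bool) :
    0 ≤ fracCross (sbLeft s) (sbLeft (s ++ t)) ∧ 0 < fracCross (sbLeft s) (sbNode (s ++ t)) ∧
      0 ≤ fracCross (sbLeft s) (sbRight (s ++ t)) := by
  induction t using List.reverseRecOn with
  | nil =>
    obtain ⟨-, -, -, h₁, -, h₂⟩ := sbTriple_invariants s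
    simp [fracCross_self, h₁, h₂]
  | append_singleton t d ih =>
    rw [← List.append_assoc]
    cases d <;>
      simp only [sbLeft_snoc_false, sbNode_snoc_false, sbRight_snoc_false, sbLeft_snoc_true,
        sbNode_snoc_true, sbRight_snoc_true, fracCross_add_right] <;> omega

theorem fracCross_sbLeft_ratFrac_pos (s t : List Bool) :
    0 < fracCross (sbLeft s) (ratFrac (sbVal (s ++ t))) := by
  have h := (fracCross_sbLeft_append s t).2.1
  have hden : (0 : ℚ) < (sbNode (s ++ t)).2 := by exact_mod_cast sbNode_den_pos (s ++ t)
  have hp : (0 : ℚ) < (sbVal (s ++ t)).den := by exact_mod_cast (sbVal (s ++ t)).den_pos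
  have hval : ((sbVal (s ++ t)).num : ℚ) =
      (sbNode (s ++ t)).1 / (sbNode (s ++ t)).2 * (sbVal (s ++ t)).den := by
    rw [← sbVal, Rat.mul_den_eq_num]
  have h' : (0 : ℚ) < fracCross (sbLeft s) (sbNode (s ++ t)) := by exact_mod_cast h
  suffices (0 : ℚ) < fracCross (sbLeft s) (ratFrac (sbVal (s ++ t))) by exact_mod_cast this
  have e : (fracCross (sbLeft s) (ratFrac (sbVal (s ++ t))) : ℚ) =
      fracCross (sbLeft s) (sbNode (s ++ t)) * (sbVal (s ++ t)).den / (sbNode (s ++ t)).2 := by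
    simp only [fracCross, ratFrac]
    push_cast
    rw [hval]
    field_simp
  rw [e]
  positivity

/-- The path to the `k`-th node approaching the node at `s` from the left:
one step left, then `k` steps right. -/
def leftApproach (s : List Bool) : ℕ → List Bool
  | 0 => s ++ [false]
  | k + 1 => leftApproach s k ++ [true]

theorem sbRight_leftApproach (s : List Bool) (k : ℕ) :
    sbRight (leftApproach s k) = sbNode s := by
  induction k with
  | zero => simp [leftApproach]
  | succ k ih => simp [leftApproach, ih]

theorem sbVal_leftApproach_lt (s : List Bool) (k : ℕ) :
    sbVal (leftApproach s k) < sbVal s := by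
  rw [sbVal_lt_sbVal_iff, ← sbRight_leftApproach s k, fracCross_sbNode_sbRight]
  exact one_pos

theorem sbVal_leftApproach_strictMono (s : List Bool) :
    StrictMono fun k => sbVal (leftApproach s k) :=
  strictMono_nat_of_lt_succ fun k => sbVal_lt_snoc_true (leftApproach s k)

theorem sbVal_snoc_false_le_leftApproach (s : List Bool) (k : ℕ) :
    sbVal (s ++ [false]) ≤ sbVal (leftApproach s k) := by
  induction k with
  | zero => exact le_rfl
  | succ k ih => exact ih.trans (sbVal_lt_snoc_true _).le

theorem lt_sbNode_leftApproach_den (s : List Bool) (k : ℕ) :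
    (k : ℤ) < (sbNode (leftApproach s k)).2 := by
  induction k with
  | zero => exact_mod_cast sbNode_den_pos _
  | succ k ih =>
    have := sbNode_den_pos s
    simp only [leftApproach, sbNode_snoc_true, sbRight_leftApproach, Prod.snd_add]
    push_cast
    omega

theorem exists_lt_sbVal_leftApproach (s : List Bool) {y : ℚ} (hy : y < sbVal s) :
    ∃ k, y < sbVal (leftApproach s k) := by
  obtain ⟨k, hk⟩ := exists_nat_gt (1 / (sbVal s - y))
  refine ⟨k, ?_⟩
  have hpos : 0 < sbVal s - y := sub_pos.2 hy
  have hsub := sbVal_sub (leftApproach s k) s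
  rw [← sbRight_leftApproach s k, fracCross_sbNode_sbRight, sbRight_leftApproach s k] at hsub
  have h₁ : (k : ℚ) < (sbNode (leftApproach s k)).2 := by
    exact_mod_cast lt_sbNode_leftApproach_den s k
  have h₂ : (1 : ℚ) ≤ (sbNode s).2 := by exact_mod_cast sbNode_den_pos s
  have h₃ : (0 : ℚ) ≤ k := k.cast_nonneg
  have h₄ : sbVal s - sbVal (leftApproach s k) < sbVal s - y := by
    rw [hsub, Int.cast_one, div_lt_iff₀ (by nlinarith)]
    rw [div_lt_iff₀ hpos] at hk
    have h₅ : (k : ℚ) < (sbNode (leftApproach s k)).2 * (sbNode s).2 := by nlinarith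
    nlinarith
  linarith

/-- If all edges at nodes in `(p, x)` are monochromatic, then `γ` takes the same value at
`p` as at every node `u ∈ (p, x)` whose left boundary lies below `p`. -/
theorem eq_of_left_spine {S : Type*} {γ : ℚ → S} {p x : ℚ}
    (hedge : ∀ u v, IsEdge u v → (p < u ∧ u < x ∨ p < v ∧ v < x) →
      Monochromatic γ (Set.uIcc u v))
    (s : List Bool) (hp : p < sbVal s) (hx : sbVal s < x)
    (hl : 0 < fracCross (sbLeft s) (ratFrac p)) : γ p = γ (sbVal s) := by
  have key : ∀ n : ℕ, ∀ s : List Bool, p < sbVal s → sbVal s < x →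
      0 < fracCross (sbLeft s) (ratFrac p) → fracCross (ratFrac p) (sbNode s) ≤ n →
      γ p = γ (sbVal s) := by
    intro n
    induction n with
    | zero =>
      intro s hp _ _ hn
      rw [lt_sbVal_iff] at hp
      push_cast at hn
      omega
    | succ n ih =>
      intro s hp hx hl hn
      have hlt := sbVal_snoc_false_lt s
      have hmon := hedge _ _ ⟨s, false, rfl, rfl⟩ (Or.inl ⟨hp, hx⟩)
      rcases le_or_gt (sbVal (s ++ [false])) p with h | h
      · exact hmon _ (Set.mem_uIcc.2 (Or.inr ⟨h, hp.le⟩)) _ Set.left_mem_uIcc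
      · rw [hmon _ Set.left_mem_uIcc _ Set.right_mem_uIcc]
        refine ih _ h (hlt.trans hx) (by simpa using hl) ?_
        have := fracCross_swap (sbLeft s) (ratFrac p)
        rw [sbNode_snoc_false, fracCross_add_right]
        push_cast at hn
        omega
  exact key _ s hp hx hl (Int.self_le_toNat _)

theorem eventually_eq_leftApproach {S : Type*} {γ : ℚ → S} {p : ℚ} {s : List Bool}
    (hedge : ∀ u v, IsEdge u v → (p < u ∧ u < sbVal s ∨ p < v ∧ v < sbVal s) →
      Monochromatic γ (Set.uIcc u v))
    (hp : p < sbVal s) (hl : 0 < fracCross (sbLeft s) (ratFrac p)) :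
    ∃ k, ∀ j ≥ k, γ (sbVal (leftApproach s j)) = γ p := by
  classical
  have hex := exists_lt_sbVal_leftApproach s hp
  have hstep : ∀ j, IsEdge (sbVal (leftApproach s j)) (sbVal (leftApproach s (j + 1))) :=
    fun j => ⟨leftApproach s j, true, rfl, rfl⟩
  refine ⟨Nat.find hex, fun j hj => ?_⟩
  induction j, hj using Nat.le_induction with
  | base =>
    have hk := Nat.find_spec hex
    have hmin := fun m => Nat.find_min (H := hex) (m := m)
    generalize Nat.find hex = k at hk hmin
    cases k with
    | zero =>
      exact (eq_of_left_spine hedge _ hk (sbVal_leftApproach_lt s 0)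
        (by simpa [leftApproach] using hl)).symm
    | succ k =>
      rcases (not_lt.1 (hmin k k.lt_succ_self)).eq_or_lt with h | h
      · have := hedge _ _ (hstep k) (Or.inr ⟨hk, sbVal_leftApproach_lt s _⟩)
        rw [← this _ Set.left_mem_uIcc _ Set.right_mem_uIcc, h]
      · refine (eq_of_left_spine hedge _ hk (sbVal_leftApproach_lt s _) ?_).symm
        simpa [leftApproach] using (sbVal_lt_iff _ _).1 h
  | succ j hj ih =>
    have hpj : p < sbVal (leftApproach s j) :=
      (Nat.find_spec hex).trans_le ((sbVal_leftApproach_strictMono s).monotone hj)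
    rw [← ih]
    exact hedge _ _ (hstep j) (Or.inl ⟨hpj, sbVal_leftApproach_lt s j⟩)
      _ Set.right_mem_uIcc _ Set.left_mem_uIcc

theorem IsIntervalPartition.merge {P₁ P₂ : List (Set ℚ)} {I J : Set ℚ}
    (h : IsIntervalPartition (P₁ ++ I :: J :: P₂)) :
    IsIntervalPartition (P₁ ++ (I ∪ J) :: P₂) := by
  obtain ⟨hconv, hpw, hcov⟩ := h
  simp only [List.pairwise_append, List.pairwise_cons, List.mem_cons] at hpw
  obtain ⟨hpw₁, ⟨hI, hJ, hpw₂⟩, hcross⟩ := hpw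
  refine ⟨?_, ?_, ?_⟩
  · intro K hK
    simp only [List.mem_append, List.mem_cons] at hK
    rcases hK with hK | rfl | hK
    · exact hconv K (by simp [hK])
    · refine ⟨(hconv I (by simp)).1.mono Set.subset_union_left, ?_⟩
      intro a ha b hb r har hrb
      obtain ⟨K, hK, hrK⟩ := hcov r
      simp only [List.mem_append, List.mem_cons] at hK
      rcases hK with hK | rfl | rfl | hK
      · have : r < a := by
          rcases ha with ha | ha
          · exact hcross K hK I (by simp) r hrK a ha
          · exact hcross K hK J (by simp) r hrK a ha
        exact absurd this har.not_gt
      · exact Or.inl hrK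
      · exact Or.inr hrK
      · have : b < r := by
          rcases hb with hb | hb
          · exact hI K (by simp [hK]) b hb r hrK
          · exact hJ K hK b hb r hrK
        exact absurd this hrb.not_gt
    · exact hconv K (by simp [hK])
  · simp only [List.pairwise_append, List.pairwise_cons, List.mem_cons]
    refine ⟨hpw₁, ⟨?_, hpw₂⟩, ?_⟩
    · rintro K hK a (ha | ha) b hb
      · exact hI K (by simp [hK]) a ha b hb
      · exact hJ K hK a ha b hb
    · rintro K hK L (rfl | hL) a ha b hb
      · rcases hb with hb | hb
        · exact hcross K hK I (by simp) a ha b hb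
        · exact hcross K hK J (by simp) a ha b hb
      · exact hcross K hK L (by simp [hL]) a ha b hb
  · intro x
    obtain ⟨K, hK, hx⟩ := hcov x
    simp only [List.mem_append, List.mem_cons] at hK
    rcases hK with hK | rfl | rfl | hK
    · exact ⟨K, by simp [hK], hx⟩
    · exact ⟨K ∪ J, by simp, Or.inl hx⟩
    · exact ⟨I ∪ K, by simp, Or.inr hx⟩
    · exact ⟨K, by simp [hK], hx⟩

theorem FinitePW.exists_isCanonicalRep {S : Type*} {γ : ℚ → S} (hγ : FinitePW γ) :
    ∃ P, IsCanonicalRep γ P := by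
  obtain ⟨P, hP, hmon⟩ := hγ
  induction hn : P.length using Nat.strong_induction_on generalizing P with
  | _ n ih =>
    by_cases hc : List.IsChain (fun I J => ∀ p ∈ I, ∀ q ∈ J, γ p ≠ γ q) P
    · exact ⟨P, hP, hmon, hc⟩
    · rw [List.isChain_iff_forall_rel_of_append_cons_cons] at hc
      push Not at hc
      obtain ⟨I, J, P₁, P₂, rfl, p, hp, q, hq, hpq⟩ := hc
      refine ih _ ?_ (P₁ ++ (I ∪ J) :: P₂) hP.merge ?_ rfl
      · simp only [← hn, List.length_append, List.length_cons]; omega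
      · intro K hK
        simp only [List.mem_append, List.mem_cons] at hK
        rcases hK with hK | rfl | hK
        · exact hmon K (by simp [hK])
        · have hval : ∀ a ∈ I ∪ J, γ a = γ p := by
            rintro a (ha | ha)
            · exact hmon I (by simp) a ha p hp
            · exact (hmon J (by simp) a ha q hq).trans hpq.symm
          exact fun a ha b hb => (hval a ha).trans (hval b hb).symm
        · exact hmon K (by simp [hK])

theorem IsLeftBound.exists_forall_ne {S : Type*} {γ : ℚ → S} {x : ℚ} (h : IsLeftBound γ x) :
    ∃ y < x, ∀ z, y ≤ z → z < x → γ z ≠ γ x := by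
  obtain ⟨P, ⟨⟨hconv, hpw, hcov⟩, -, hchain⟩, I, hI, hx, hleast⟩ := h
  have hchain' := List.isChain_iff_getElem.1 hchain
  rw [List.pairwise_iff_getElem] at hpw
  obtain ⟨j, hj, rfl⟩ := List.getElem_of_mem hI
  have below : ∀ z < x, ∀ k, ∀ hk : k < P.length, z ∈ P[k] → k < j := by
    intro z hz k hk hzk
    rcases lt_trichotomy k j with h | rfl | h
    · exact h
    · exact absurd (hleast hzk) hz.not_ge
    · exact absurd (hpw j k hj hk h x hx z hzk) hz.not_gt
  obtain ⟨K, hK, hK'⟩ := hcov (x - 1)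
  obtain ⟨k, hk, rfl⟩ := List.getElem_of_mem hK
  have hkj := below (x - 1) (by linarith) k hk hK'
  obtain ⟨j, rfl⟩ : ∃ i, j = i + 1 := ⟨j - 1, by omega⟩
  obtain ⟨y, hy⟩ := (hconv P[j] (List.getElem_mem _)).1
  refine ⟨y, hpw j (j + 1) _ hj (by omega) y hy x hx, fun z hyz hzx => ?_⟩
  obtain ⟨L, hL, hzL⟩ := hcov z
  obtain ⟨l, hl, rfl⟩ := List.getElem_of_mem hL
  have hlj := below z hzx l hl hzL
  obtain rfl : l = j := by
    by_contra hne
    exact absurd (hpw l j hl (by omega) (by omega) z hzL y hy) hyz.not_gt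
  exact hchain' l hj z hzL x hx

theorem FinitePW.isLeftBound {S : Type*} {γ : ℚ → S} (hγ : FinitePW γ) {x : ℚ}
    (h : ∀ y < x, ∃ z, y ≤ z ∧ z < x ∧ γ z ≠ γ x) : IsLeftBound γ x := by
  obtain ⟨P, hP⟩ := hγ.exists_isCanonicalRep
  obtain ⟨I, hI, hx⟩ := hP.1.2.2 x
  refine ⟨P, hP, I, hI, hx, fun y hy => ?_⟩
  by_contra! hyx
  obtain ⟨z, hyz, hzx, hne⟩ := h y hyx
  refine hne (hP.2.1 I hI z ?_ x hx)
  rcases hyz.eq_or_lt with rfl | hlt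
  · exact hy
  · exact (hP.1.1 I hI).2 y hy x hx z hlt hzx

/-- Proposition 3, part 1: let `γ` be a finite piecewise function and
`D = (q 0, A 0), …, (q (m-1), A (m-1))` with `q` increasing, `γ (q i) = A i`, and such
that both endpoints of every break link of `γ` occur among the `q i`. Then `q i` is a
left-bound of `γ` iff `i ≥ 1`, `q (i-1)` is a descendant of `q i`, and `A (i-1) ≠ A i`. -/
theorem left_bound_characterization {S : Type*} [Finite S]
    (γ : ℚ → S) (hγ : FinitePW γ) (m : ℕ) (q : ℕ → ℚ) (A : ℕ → S)
    (hmono : ∀ i j, i < j → j < m → q i < q j)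
    (hlab : ∀ i < m, γ (q i) = A i)
    (hall : ∀ p p' : ℚ, IsBreakLink γ p p' → (∃ i < m, q i = p) ∧ (∃ i < m, q i = p'))
    (i : ℕ) (hi : i < m) :
    IsLeftBound γ (q i) ↔
      (0 < i ∧ IsAncestor (q i) (q (i - 1)) ∧ A (i - 1) ≠ A i) := by
  have hmono' : ∀ {j k}, j < m → q j < q k → j < k := by
    intro j k hj hjk
    by_contra! hkj
    rcases hkj.eq_or_lt with rfl | h
    · exact lt_irrefl _ hjk
    · exact absurd (hmono k j h hj) hjk.not_gt
  have hgap : 0 < i → ∀ u v, IsEdge u v →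
      (q (i - 1) < u ∧ u < q i ∨ q (i - 1) < v ∧ v < q i) →
      Monochromatic γ (Set.uIcc u v) := by
    intro h0 u v huv hmem
    by_contra hmon
    obtain ⟨⟨a, ha, rfl⟩, b, hb, rfl⟩ := hall u v ⟨huv, Or.inr hmon⟩
    rcases hmem with ⟨h₁, h₂⟩ | ⟨h₁, h₂⟩
    · have := hmono' (by omega) h₁
      have := hmono' ha h₂
      omega
    · have := hmono' (by omega) h₁
      have := hmono' hb h₂
      omega
  constructor
  · intro hlb
    obtain ⟨y, hyx, hy⟩ := hlb.exists_forall_ne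
    obtain ⟨s, hs⟩ := exists_sbVal_eq (q i)
    obtain ⟨k, hk⟩ := exists_lt_sbVal_leftApproach s (hs ▸ hyx)
    have hne : ∀ j ≥ k, γ (sbVal (leftApproach s j)) ≠ γ (q i) := fun j hj =>
      hy _ (hk.le.trans ((sbVal_leftApproach_strictMono s).monotone hj))
        (hs ▸ sbVal_leftApproach_lt s j)
    have hbreak : IsBreakLink γ (q i) (sbVal (s ++ [false])) := by
      refine ⟨⟨s, false, hs, rfl⟩, Or.inr fun hmon => ?_⟩
      refine hne k le_rfl (hmon _ (Set.mem_uIcc.2 (Or.inr ⟨?_, ?_⟩)) _ Set.left_mem_uIcc)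
      · exact sbVal_snoc_false_le_leftApproach s k
      · exact hs ▸ (sbVal_leftApproach_lt s k).le
    obtain ⟨a, ha, hqa⟩ := (hall _ _ hbreak).2
    have hai : a < i := hmono' ha (by rw [hqa, ← hs]; exact sbVal_snoc_false_lt s)
    have h0 : 0 < i := by omega
    have hlt : q (i - 1) < sbVal s := hs ▸ hmono _ _ (by omega) hi
    have hle : sbVal (s ++ [false]) ≤ q (i - 1) := by
      rw [← hqa]
      rcases (show a ≤ i - 1 by omega).eq_or_lt with h | h
      · rw [h]
      · exact (hmono _ _ h (by omega)).le
    have hdesc : ∃ t, sbVal (s ++ false :: t) = q (i - 1) := by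
      rcases hle.eq_or_lt with h | h
      · exact ⟨[], h⟩
      · obtain ⟨t, ht⟩ := (exists_descendant_of_between _ _ (s ++ [false])).2
          (by rw [sbRight_snoc_false]; exact (lt_sbVal_iff _ _).1 hlt) h (Int.self_le_toNat _)
        exact ⟨true :: t, by rw [← ht, List.append_assoc, List.singleton_append]⟩
    obtain ⟨t, ht⟩ := hdesc
    refine ⟨h0, ⟨s, false :: t, hs, by simp, ht⟩, fun hA => ?_⟩
    obtain ⟨l, hl⟩ := eventually_eq_leftApproach (s := s) (by rw [hs]; exact hgap h0) hlt
      (ht ▸ fracCross_sbLeft_ratFrac_pos s _)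
    apply hne (max k l) (le_max_left _ _)
    rw [hl _ (le_max_right _ _), hlab _ (by omega), hlab _ hi, hA]
  · rintro ⟨h0, ⟨s, t, hs, -, ht⟩, hA⟩
    have hlt : q (i - 1) < sbVal s := hs ▸ hmono _ _ (by omega) hi
    obtain ⟨l, hl⟩ := eventually_eq_leftApproach (s := s) (by rw [hs]; exact hgap h0) hlt
      (ht ▸ fracCross_sbLeft_ratFrac_pos s t)
    refine hγ.isLeftBound fun y hy => ?_
    obtain ⟨k, hk⟩ := exists_lt_sbVal_leftApproach s (hs ▸ hy)
    refine ⟨sbVal (leftApproach s (max k l)),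
      hk.le.trans ((sbVal_leftApproach_strictMono s).monotone (le_max_left k l)),
      hs ▸ sbVal_leftApproach_lt s _, ?_⟩
    rw [hl _ (le_max_right _ _), hlab _ (by omega), hlab _ hi]
    exact hA
end
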